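/- Let M be a compact metric space, φ:ℝ×M→M a continuous flow without fixed points, and ε₀(φ) = inf({τ>0 : ∃x∈M with φ_τ(x)=x and φ_t(x)≠x for all t∈(0,τ)} ∪ {1}). Then there exist a family {S_x : x∈M} of closed subsets of M and constants μ∈(0, ε₀(φ)/3), δ>0 such that: for every x∈M there is a continuous function τ: B̄_δ(x)→[−μ,μ] with τ(x)=0 and φ_{τ(p)}(p)∈S_x for every p∈B̄_δ(x); moreover, for every x∈M and p∈B_δ(x) there exist −μ ≤ l₁ < 0 < l₂ ≤ μ such that φ_{l₁}(p)∈∂B_δ(x), φ_{l₂}(p)∈∂B_δ(x), φ_t(p)∈B_δ(x) for all t∈(l₁,l₂), and for every q∈{φ_t(p) : t∈[l₁,l₂]} one has φ_{τ(q)}(q) = φ_{τ(p)}(p). -/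

import Mathlib

open Set Filter Topology

/-- Positivity on the diagonal at parameter `0` extends to a uniform neighbourhood. -/
lemma exists_pos_near_diagonal {M : Type*} [MetricSpace M] [CompactSpace M]
    {g : ℝ × M × M → ℝ} (hg : Continuous g) (hpos : ∀ x, 0 < g (0, x, x)) :
    ∃ ε > 0, ∀ t x p, |t| ≤ ε → dist p x ≤ ε → 0 < g (t, x, p) := by
  have hK : IsCompact (range fun x : M => ((0 : ℝ), x, x)) :=
    isCompact_range (by fun_prop)
  obtain ⟨ε, hε, hsub⟩ := hK.exists_thickening_subset_open
    (isOpen_lt continuous_const hg) (by rintro _ ⟨x, rfl⟩; exact hpos x)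
  refine ⟨ε / 2, half_pos hε, fun t x p ht hp => hsub ?_⟩
  refine Metric.mem_thickening_iff.2 ⟨_, ⟨x, rfl⟩, ?_⟩
  simp only [Prod.dist_eq, dist_self, Real.dist_eq, sub_zero, max_lt_iff]
  exact ⟨by linarith, hε, by linarith⟩

/-- A path leaving an open set has a first exit time, at which it lies on the frontier. -/
lemma exists_first_exit {X : Type*} [TopologicalSpace X] {U : Set X} (hU : IsOpen U)
    {γ : ℝ → X} (hγ : Continuous γ) {b : ℝ} (hb : 0 ≤ b) (h0 : γ 0 ∈ U) (hout : γ b ∉ U) :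
    ∃ l, 0 < l ∧ l ≤ b ∧ γ l ∈ frontier U ∧ ∀ t ∈ Ico 0 l, γ t ∈ U := by
  have hc : IsCompact (Icc 0 b ∩ γ ⁻¹' Uᶜ) :=
    isCompact_Icc.inter_right (hU.isClosed_compl.preimage hγ)
  obtain ⟨l, ⟨hl, hlU⟩, hmin⟩ := hc.exists_isLeast ⟨b, ⟨hb, le_rfl⟩, hout⟩
  have hl0 : 0 < l := hl.1.lt_of_ne (by rintro rfl; exact hlU h0)
  have hin : ∀ t ∈ Ico 0 l, γ t ∈ U := fun t ht => by
    by_contra h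
    exact absurd (hmin ⟨⟨ht.1, ht.2.le.trans hl.2⟩, h⟩) (not_le.2 ht.2)
  refine ⟨l, hl0, hl.2, ?_, hin⟩
  rw [hU.frontier_eq]
  refine ⟨map_mem_closure hγ ?_ hin, hlU⟩
  rw [closure_Ico hl0.ne]
  exact ⟨hl0.le, le_rfl⟩

section Flow

variable {M : Type*} [MetricSpace M] {φ : ℝ → M → M}

/-- A flow without fixed points on a compact space has no periods below some positive bound. -/
lemma exists_lower_bound_periods [CompactSpace M]
    (hφcont : Continuous fun p : ℝ × M => φ p.1 p.2)
    (hφ0 : ∀ x, φ 0 x = x)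
    (hφadd : ∀ t s x, φ (t + s) x = φ t (φ s x))
    (hnofix : ∀ x : M, ∃ t : ℝ, φ t x ≠ x) :
    ∃ η > 0, ∀ t x, 0 < t → t < η → φ t x ≠ x := by
  have key : ∀ᶠ t : ℝ in 𝓝 0, ∀ x ∈ (univ : Set M), 0 < t → φ t x ≠ x := by
    refine isCompact_univ.eventually_forall_of_forall_eventually fun x _ => ?_
    obtain ⟨s, hs⟩ := hnofix x
    have hopen : IsOpen {z : ℝ × M | φ z.1 z.2 ≠ φ s z.2} :=
      isOpen_ne_fun hφcont (hφcont.comp (continuous_const.prodMk continuous_snd))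
    have hmem : {z : ℝ × M | φ z.1 z.2 ≠ φ s z.2} ∈ 𝓝 ((0 : ℝ), x) :=
      hopen.mem_nhds (by simpa [hφ0] using hs.symm)
    obtain ⟨ε, hε, hball⟩ := Metric.mem_nhds_iff.1 hmem
    filter_upwards [Metric.ball_mem_nhds ((0 : ℝ), x) hε] with z hz hpos hper
    have hz' : |z.1| < ε ∧ dist z.2 x < ε := by
      simpa [Prod.dist_eq] using hz
    have hnat : ∀ n : ℕ, ∀ y, φ z.1 y = y → φ (n * z.1) y = y := by
      intro n y hy
      induction n with
      | zero => simp [hφ0]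
      | succ n ih => rw [Nat.cast_succ, add_mul, one_mul, hφadd, hy, ih]
    have hint : ∀ n : ℤ, φ (n * z.1) z.2 = z.2 := by
      intro n
      obtain ⟨m, rfl | rfl⟩ := n.eq_nat_or_neg
      · exact_mod_cast hnat m _ hper
      · have h1 := hφadd (-(m * z.1)) (m * z.1) z.2
        rw [neg_add_cancel, hφ0, hnat m _ hper] at h1
        push_cast
        rw [neg_mul]
        exact h1.symm
    have hr0 := Int.sub_floor_div_mul_nonneg s hpos
    have hr1 := Int.sub_floor_div_mul_lt s hpos
    have hmem' : (s - ⌊s / z.1⌋ * z.1, z.2) ∈ Metric.ball ((0 : ℝ), x) ε := by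
      have := hz'.1
      rw [abs_of_pos hpos] at this
      simp only [Metric.mem_ball, Prod.dist_eq, Real.dist_eq, sub_zero, max_lt_iff]
      exact ⟨by rw [abs_of_nonneg hr0]; linarith, hz'.2⟩
    refine hball hmem' ?_
    have h2 := hφadd (s - ⌊s / z.1⌋ * z.1) (⌊s / z.1⌋ * z.1) z.2
    rw [hint, sub_add_cancel] at h2
    exact h2.symm
  obtain ⟨η, hη, h⟩ := Metric.eventually_nhds_iff.1 key
  refine ⟨η, hη, fun t x h0 h1 => h ?_ x (mem_univ x) h0⟩
  simpa [abs_of_pos h0] using h1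

lemma continuous_flow (hφcont : Continuous fun p : ℝ × M => φ p.1 p.2)
    {Y : Type*} [TopologicalSpace Y] {f : Y → ℝ} {g : Y → M}
    (hf : Continuous f) (hg : Continuous g) : Continuous fun y => φ (f y) (g y) :=
  hφcont.comp (hf.prodMk hg)

/-- The integral of the distance to `x` along the orbit segment of length `T` starting at `p`. -/
noncomputable def orbitIntegral (φ : ℝ → M → M) (T : ℝ) (x p : M) : ℝ :=
  ∫ s in (0 : ℝ)..T, dist (φ s p) x

lemma continuous_orbitIntegral (hφcont : Continuous fun p : ℝ × M => φ p.1 p.2) (T : ℝ)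
    {Y : Type*} [TopologicalSpace Y] {f g : Y → M} (hf : Continuous f) (hg : Continuous g) :
    Continuous fun y => orbitIntegral φ T (f y) (g y) := by
  have hcont : Continuous fun z : M × M => orbitIntegral φ T z.1 z.2 := by
    refine intervalIntegral.continuous_parametric_intervalIntegral_of_continuous'
      (f := fun (z : M × M) s => dist (φ s z.2) z.1) ?_ 0 T
    exact (continuous_flow hφcont continuous_snd continuous_fst.snd).dist continuous_fst.fst
  exact hcont.comp (hf.prodMk hg)

lemma hasDerivAt_orbitIntegral (hφcont : Continuous fun p : ℝ × M => φ p.1 p.2)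
    (hφadd : ∀ t s x, φ (t + s) x = φ t (φ s x)) (T : ℝ) (x p : M) (t : ℝ) :
    HasDerivAt (fun t => orbitIntegral φ T x (φ t p))
      (dist (φ (T + t) p) x - dist (φ t p) x) t := by
  have hf : Continuous fun s => dist (φ s p) x :=
    (hφcont.comp (continuous_id.prodMk continuous_const)).dist continuous_const
  have heq : (fun t => orbitIntegral φ T x (φ t p)) =
      fun t => (∫ s in (0 : ℝ)..(T + t), dist (φ s p) x) - ∫ s in (0 : ℝ)..t, dist (φ s p) x := by
    funext t
    simp only [orbitIntegral, ← hφadd]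
    rw [intervalIntegral.integral_interval_sub_left (hf.intervalIntegrable _ _)
      (hf.intervalIntegrable _ _),
      intervalIntegral.integral_comp_add_right (fun s => dist (φ s p) x), zero_add]
  rw [heq]
  exact ((hf.integral_hasStrictDerivAt 0 (T + t)).hasDerivAt.comp_const_add T t).sub
    (hf.integral_hasStrictDerivAt 0 t).hasDerivAt

end Flow

/-- If `F p` is strictly increasing on `[-2μ, 2μ]` and attains `c` at `τ p ∈ [-μ, μ]`,
for `p ∈ K`, then `τ` is continuous on `K`. -/
lemma continuousOn_of_strictMonoOn_level {X : Type*} [TopologicalSpace X] {K : Set X}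
    {F : X → ℝ → ℝ} (hF : ∀ t, Continuous fun p => F p t) {μ c : ℝ} (hμ : 0 < μ)
    (hmono : ∀ p ∈ K, StrictMonoOn (F p) (Icc (-(2 * μ)) (2 * μ))) {τ : X → ℝ}
    (hτ : ∀ p ∈ K, τ p ∈ Icc (-μ) μ) (hlevel : ∀ p ∈ K, F p (τ p) = c) :
    ContinuousOn τ K := by
  have hIcc : ∀ p ∈ K, τ p ∈ Icc (-(2 * μ)) (2 * μ) := fun p hp =>
    ⟨by linarith [(hτ p hp).1], by linarith [(hτ p hp).2]⟩
  intro p hp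
  obtain ⟨h1, h2⟩ := hτ p hp
  refine tendsto_order.2 ⟨fun a ha => ?_, fun b hb => ?_⟩
  · have hlt : max a (τ p - μ) < τ p := max_lt ha (by linarith)
    have hmem : max a (τ p - μ) ∈ Icc (-(2 * μ)) (2 * μ) :=
      ⟨by linarith [le_max_right a (τ p - μ)], by linarith⟩
    have hc : F p (max a (τ p - μ)) < c := hlevel p hp ▸ hmono p hp hmem (hIcc p hp) hlt
    filter_upwards [self_mem_nhdsWithin,
      mem_nhdsWithin_of_mem_nhds ((hF _).continuousAt.eventually_lt_const hc)] with q hq hqc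
    rw [← hlevel q hq, (hmono q hq).lt_iff_lt hmem (hIcc q hq)] at hqc
    exact (le_max_left _ _).trans_lt hqc
  · have hlt : τ p < min b (τ p + μ) := lt_min hb (by linarith)
    have hmem : min b (τ p + μ) ∈ Icc (-(2 * μ)) (2 * μ) :=
      ⟨by linarith, by linarith [min_le_right b (τ p + μ)]⟩
    have hc : c < F p (min b (τ p + μ)) := hlevel p hp ▸ hmono p hp (hIcc p hp) hmem hlt
    filter_upwards [self_mem_nhdsWithin,
      mem_nhdsWithin_of_mem_nhds ((hF _).continuousAt.eventually_const_lt hc)] with q hq hqc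
    rw [← hlevel q hq, (hmono q hq).lt_iff_lt (hIcc q hq) hmem] at hqc
    exact hqc.trans_le (min_le_left _ _)


/-- Existence of a family of local cross sections `{S_x}` for a
fixed-point-free continuous flow on a compact metric space (Lemma 2.4 of the paper). -/
theorem stmt_8 {M : Type*} [MetricSpace M] [CompactSpace M]
    (φ : ℝ → M → M)
    (hφcont : Continuous fun p : ℝ × M => φ p.1 p.2)
    (hφ0 : ∀ x, φ 0 x = x)
    (hφadd : ∀ t s x, φ (t + s) x = φ t (φ s x))
    (hnofix : ∀ x : M, ∃ t : ℝ, φ t x ≠ x)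
    (ε₀ : ℝ)
    (hε₀ : ε₀ = sInf ({τ : ℝ | 0 < τ ∧ ∃ x : M, φ τ x = x ∧ ∀ t ∈ Set.Ioo 0 τ, φ t x ≠ x}
      ∪ {1})) :
    ∃ S : M → Set M, (∀ x : M, IsClosed (S x)) ∧
      ∃ μ ∈ Set.Ioo 0 (ε₀ / 3), ∃ δ > 0, ∀ x : M,
        ∃ τ : M → ℝ, ContinuousOn τ (closure (Metric.ball x δ)) ∧ τ x = 0 ∧
          (∀ p ∈ closure (Metric.ball x δ), τ p ∈ Set.Icc (-μ) μ ∧ φ (τ p) p ∈ S x) ∧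
          ∀ p ∈ Metric.ball x δ, ∃ l₁ l₂ : ℝ,
            -μ ≤ l₁ ∧ l₁ < 0 ∧ 0 < l₂ ∧ l₂ ≤ μ ∧
            φ l₁ p ∈ frontier (Metric.ball x δ) ∧
            φ l₂ p ∈ frontier (Metric.ball x δ) ∧
            (∀ t ∈ Set.Ioo l₁ l₂, φ t p ∈ Metric.ball x δ) ∧
            ∀ t ∈ Set.Icc l₁ l₂, φ (τ (φ t p)) (φ t p) = φ (τ p) p := by
  obtain ⟨η, hη, hper⟩ := exists_lower_bound_periods hφcont hφ0 hφadd hnofix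
  have hε₀pos : 0 < ε₀ := by
    refine lt_of_lt_of_le (lt_min hη one_pos) (hε₀ ▸ le_csInf ⟨1, Or.inr rfl⟩ ?_)
    rintro t (⟨ht, x, hx, -⟩ | rfl)
    · exact (min_le_left _ _).trans (not_lt.1 fun h => hper t x ht h hx)
    · exact min_le_right _ _
  obtain ⟨T, hT₀, hTη⟩ := exists_between hη
  set h := orbitIntegral φ T
  have hx : Continuous fun z : ℝ × M × M => z.2.1 := continuous_snd.fst
  have hp : Continuous fun z : ℝ × M × M => z.2.2 := continuous_snd.snd
  obtain ⟨ε₁, hε₁, hD⟩ := exists_pos_near_diagonal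
    (g := fun z : ℝ × M × M => dist (φ (T + z.1) z.2.2) z.2.1 - dist (φ z.1 z.2.2) z.2.1)
    (((continuous_flow hφcont (continuous_const.add continuous_fst) hp).dist hx).sub
      ((continuous_flow hφcont continuous_fst hp).dist hx))
    (fun x => by simpa [hφ0] using hper T x hT₀ hTη)
  obtain ⟨μ, hμ, hμlt⟩ : ∃ μ > 0, μ < min (ε₁ / 2) (min η (ε₀ / 3)) :=
    exists_between (lt_min (by linarith) (lt_min hη (by linarith)))
  obtain ⟨hμ₁, hμη, hμ₀⟩ : μ < ε₁ / 2 ∧ μ < η ∧ μ < ε₀ / 3 := by simpa using hμlt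
  have hmono : ∀ x p, dist p x ≤ ε₁ →
      StrictMonoOn (fun t => h x (φ t p)) (Icc (-(2 * μ)) (2 * μ)) := by
    intro x p hxp
    have hd := hasDerivAt_orbitIntegral hφcont hφadd T x p
    refine strictMonoOn_of_deriv_pos (convex_Icc _ _)
      (fun t _ => (hd t).continuousAt.continuousWithinAt) fun t ht => ?_
    rw [(hd t).deriv]
    rw [interior_Icc] at ht
    exact hD t x p (abs_le.2 ⟨by linarith [ht.1], by linarith [ht.2]⟩) hxp
  have hmem0 : (0 : ℝ) ∈ Icc (-(2 * μ)) (2 * μ) := ⟨by linarith, by linarith⟩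
  have hneg : ∀ x, φ (-μ) x ≠ x := fun x hx => by
    have h1 := hφadd μ (-μ) x
    rw [add_neg_cancel, hφ0, hx] at h1
    exact hper μ x hμ hμη h1.symm
  obtain ⟨ε₂, hε₂, hup⟩ := exists_pos_near_diagonal
    (g := fun z : ℝ × M × M => h z.2.1 (φ μ z.2.2) - h z.2.1 z.2.1)
    ((continuous_orbitIntegral hφcont T hx (continuous_flow hφcont continuous_const hp)).sub
      (continuous_orbitIntegral hφcont T hx hx))
    (fun x => by
      have := hmono x x (by simpa using hε₁.le) hmem0 ⟨by linarith, by linarith⟩ hμ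
      simpa [hφ0] using this)
  obtain ⟨ε₃, hε₃, hdown⟩ := exists_pos_near_diagonal
    (g := fun z : ℝ × M × M => h z.2.1 z.2.1 - h z.2.1 (φ (-μ) z.2.2))
    ((continuous_orbitIntegral hφcont T hx hx).sub
      (continuous_orbitIntegral hφcont T hx (continuous_flow hφcont continuous_const hp)))
    (fun x => by
      have := hmono x x (by simpa using hε₁.le) ⟨by linarith, by linarith⟩ hmem0
        (neg_lt_zero.2 hμ)
      simpa [hφ0] using this)
  obtain ⟨ε₄, hε₄, hfwd⟩ := exists_pos_near_diagonal
    (g := fun z : ℝ × M × M => dist (φ μ z.2.2) z.2.1 - z.1)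
    (((continuous_flow hφcont continuous_const hp).dist hx).sub continuous_fst)
    (fun x => by simpa using hper μ x hμ hμη)
  obtain ⟨ε₅, hε₅, hbwd⟩ := exists_pos_near_diagonal
    (g := fun z : ℝ × M × M => dist (φ (-μ) z.2.2) z.2.1 - z.1)
    (((continuous_flow hφcont continuous_const hp).dist hx).sub continuous_fst)
    (fun x => by simpa using hneg x)
  obtain ⟨δ, hδ, hδlt⟩ : ∃ δ > 0, δ < min ε₁ (min ε₂ (min ε₃ (min ε₄ ε₅))) :=
    exists_between (by simp [*])
  obtain ⟨hδ₁, hδ₂, hδ₃, hδ₄, hδ₅⟩ : δ < ε₁ ∧ δ < ε₂ ∧ δ < ε₃ ∧ δ < ε₄ ∧ δ < ε₅ := by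
    simpa using hδlt
  refine ⟨fun x => {y | h x y = h x x},
    fun x => isClosed_eq (continuous_orbitIntegral hφcont T continuous_const continuous_id)
      continuous_const,
    μ, ⟨hμ, hμ₀⟩, δ, hδ, fun x => ?_⟩
  have hcl : ∀ p ∈ closure (Metric.ball x δ), dist p x ≤ δ := fun p hp =>
    Metric.closure_ball_subset_closedBall hp
  have hex : ∀ p, ∃ t, p ∈ closure (Metric.ball x δ) →
      t ∈ Icc (-μ) μ ∧ h x (φ t p) = h x x := by
    intro p
    by_cases hpc : p ∈ closure (Metric.ball x δ)
    · have hd := hcl p hpc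
      have h1 := hup 0 x p (by simpa using hε₂.le) (by linarith)
      have h2 := hdown 0 x p (by simpa using hε₃.le) (by linarith)
      obtain ⟨t, ht, hteq⟩ := intermediate_value_Icc (f := fun t => h x (φ t p))
        (by linarith : -μ ≤ μ)
        (continuous_orbitIntegral hφcont T continuous_const
          (continuous_flow hφcont continuous_id continuous_const)).continuousOn
        ⟨(sub_pos.1 h2).le, (sub_pos.1 h1).le⟩
      exact ⟨t, fun _ => ⟨ht, hteq⟩⟩
    · exact ⟨0, fun h => absurd h hpc⟩
  choose τ hτ using hex
  have huniq : ∀ p ∈ closure (Metric.ball x δ), ∀ t ∈ Icc (-(2 * μ)) (2 * μ),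
      h x (φ t p) = h x x → t = τ p := by
    intro p hp t ht hteq
    obtain ⟨⟨ha, hb⟩, hc⟩ := hτ p hp
    exact (hmono x p ((hcl p hp).trans hδ₁.le)).injOn ht ⟨by linarith, by linarith⟩
      (hteq.trans hc.symm)
  refine ⟨τ, ?_, ?_, fun p hp => hτ p hp, fun p hp => ?_⟩
  · exact continuousOn_of_strictMonoOn_level (F := fun p t => h x (φ t p))
      (fun t => continuous_orbitIntegral hφcont T continuous_const
        (continuous_flow hφcont continuous_const continuous_id)) hμ
      (fun p hp => hmono x p ((hcl p hp).trans hδ₁.le)) (fun p hp => (hτ p hp).1)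
      (fun p hp => (hτ p hp).2)
  · exact (huniq x (subset_closure (Metric.mem_ball_self hδ)) 0 hmem0 (by rw [hφ0])).symm
  · have hpd : dist p x < δ := hp
    have hγ : Continuous fun t => φ t p := continuous_flow hφcont continuous_id continuous_const
    have hpc := subset_closure hp
    have hout₁ : φ μ p ∉ Metric.ball x δ := fun hm => by
      have := hfwd δ x p (by rw [abs_of_pos hδ]; linarith) (by linarith)
      exact lt_asymm (sub_pos.1 this) hm
    have hout₂ : φ (-μ) p ∉ Metric.ball x δ := fun hm => by
      have := hbwd δ x p (by rw [abs_of_pos hδ]; linarith) (by linarith)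
      exact lt_asymm (sub_pos.1 this) hm
    obtain ⟨l₂, hl₂, hl₂μ, hfr₂, hin₂⟩ := exists_first_exit Metric.isOpen_ball hγ hμ.le
      (by simpa [hφ0] using hpd) hout₁
    obtain ⟨l₁, hl₁, hl₁μ, hfr₁, hin₁⟩ := exists_first_exit Metric.isOpen_ball
      (hγ.comp continuous_neg) hμ.le (by simpa [hφ0] using hpd) hout₂
    have hin : ∀ t ∈ Ioo (-l₁) l₂, φ t p ∈ Metric.ball x δ := fun t ht => by
      rcases le_total 0 t with h0 | h0
      · exact hin₂ t ⟨h0, ht.2⟩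
      · simpa using hin₁ (-t) ⟨by linarith, by linarith [ht.1]⟩
    refine ⟨-l₁, l₂, by linarith, by linarith, hl₂, hl₂μ, hfr₁, hfr₂, hin, fun t ht => ?_⟩
    have hqc : φ t p ∈ closure (Metric.ball x δ) := by
      refine map_mem_closure (f := fun t => φ t p) hγ ?_ hin
      rwa [closure_Ioo (by linarith)]
    obtain ⟨⟨ha, hb⟩, -⟩ := hτ p hpc
    have hkey : τ p - t = τ (φ t p) := by
      refine huniq _ hqc _ ⟨by linarith [ht.2], by linarith [ht.1]⟩ ?_
      rw [← hφadd, sub_add_cancel]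
      exact (hτ p hpc).2
    rw [← hkey, ← hφadd, sub_add_cancel]
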